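/- Let n ≥ 1, ε ∈ {−1, 1}, and let ρ = ∑_{k=1}^n a_k e_k ∈ ℤⁿ with a_k ∈ {0, ε} for all k and with nonempty support supp(ρ). Then R(ρ) = ⋃_{j ∈ supp(ρ)} {(ε − a_k)·e_k − ε·e_j : k ∈ {1,…,n}}, and the cardinality of R(ρ) equals |supp(ρ)|·(n + 1 − |supp(ρ)|). -/

import Mathlib

open Pointwise

section Lattice

/-- The standard dot product on `ℤⁿ`. -/
def dotZ {n : ℕ} (x y : Fin n → ℤ) : ℤ := ∑ i, x i * y i

/-- The set of Demazure roots of a set `S ⊆ ℤⁿ`. -/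
def demRoots {n : ℕ} (S : Set (Fin n → ℤ)) : Set (Fin n → ℤ) :=
  {α | ∃ ρ ∈ S, dotZ ρ α = -1 ∧ ∀ ρ' ∈ S, ρ' ≠ ρ → 0 ≤ dotZ ρ' α}

/-- The standard basis vector `eᵢ` of `ℤⁿ`. -/
def eZ (n : ℕ) (i : Fin n) : Fin n → ℤ := Pi.single i 1

/-- `e₀ := −(e₁ + ⋯ + eₙ)`, i.e. the all-(−1) vector. -/
def e0Z (n : ℕ) : Fin n → ℤ := fun _ => -1

/-- `Sₙ := {e₀, e₁, …, eₙ}`, the 1-skeleton (ray generators) of `ℙⁿ`. -/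
def SnZ (n : ℕ) : Set (Fin n → ℤ) := insert (e0Z n) (Set.range (eZ n))

/-- `Rₙ := {eᵢ} ∪ {−eᵢ} ∪ {eᵢ − eⱼ : i ≠ j}`, the root system of `PGL_{n+1}`. -/
def RnZ (n : ℕ) : Set (Fin n → ℤ) :=
  Set.range (eZ n) ∪ Set.range (fun i => -eZ n i) ∪
    {α | ∃ i j : Fin n, i ≠ j ∧ α = eZ n i - eZ n j}

end Lattice

/-- `R(ρ) := {α ∈ Rₙ : ⟨ρ, α⟩ = −1}`. -/
def RofRho (n : ℕ) (ρ : Fin n → ℤ) : Set (Fin n → ℤ) :=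
  {α | α ∈ RnZ n ∧ dotZ ρ α = -1}

/-- `supp(ρ)`: the set of indices of nonzero coordinates of `ρ`. -/
def suppZ (n : ℕ) (ρ : Fin n → ℤ) : Set (Fin n) := {k | ρ k ≠ 0}

lemma dotZ_eq_dotProduct {n : ℕ} (x y : Fin n → ℤ) : dotZ x y = x ⬝ᵥ y := rfl

lemma dotZ_eZ {n : ℕ} (ρ : Fin n → ℤ) (i : Fin n) : dotZ ρ (eZ n i) = ρ i := by
  simp [dotZ_eq_dotProduct, eZ]

lemma dotZ_neg {n : ℕ} (ρ α : Fin n → ℤ) : dotZ ρ (-α) = -dotZ ρ α := by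
  simp [dotZ_eq_dotProduct]

lemma dotZ_sub {n : ℕ} (ρ α β : Fin n → ℤ) : dotZ ρ (α - β) = dotZ ρ α - dotZ ρ β := by
  simp [dotZ_eq_dotProduct]

lemma eZ_apply {n : ℕ} (i k : Fin n) : eZ n i k = if k = i then 1 else 0 := by
  simp [eZ, Pi.single_apply]

lemma RofRho_eq {n : ℕ} {ε : ℤ} (hε : ε = -1 ∨ ε = 1) {ρ : Fin n → ℤ}
    (hρ : ∀ k, ρ k = 0 ∨ ρ k = ε) :
    RofRho n ρ =
      {α | ∃ j ∈ suppZ n ρ, ∃ k : Fin n, α = (ε - ρ k) • eZ n k - ε • eZ n j} := by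
  ext α
  simp only [RofRho, RnZ, suppZ, Set.mem_ofPred_eq, Set.mem_union, Set.mem_range]
  constructor
  · rintro ⟨(⟨i, rfl⟩ | ⟨i, rfl⟩) | ⟨i, j, -, rfl⟩, h⟩
    · rw [dotZ_eZ] at h
      obtain rfl : ε = -1 := by grind
      exact ⟨i, by simp [h], i, by simp [h]⟩
    · rw [dotZ_neg, dotZ_eZ, neg_inj] at h
      obtain rfl : ε = 1 := by grind
      exact ⟨i, by simp [h], i, by simp [h]⟩
    · rw [dotZ_sub, dotZ_eZ, dotZ_eZ] at h
      rcases hε with rfl | rfl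
      · have hi : ρ i = -1 := by grind
        have hj : ρ j = 0 := by grind
        exact ⟨i, by simp [hi], j, by simp [hj]; abel⟩
      · have hi : ρ i = 0 := by grind
        have hj : ρ j = 1 := by grind
        exact ⟨j, by simp [hj], i, by simp [hi]⟩
  · rintro ⟨j, hj, k, rfl⟩
    have hj' : ρ j = ε := (hρ j).resolve_left hj
    rcases hρ k with hk | hk
    · have hjk : j ≠ k := fun h => hj (h ▸ hk)
      rcases hε with rfl | rfl
      · have h : (-1 - ρ k) • eZ n k - (-1 : ℤ) • eZ n j = eZ n j - eZ n k := by
          simp [hk]; abel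
        rw [h]
        exact ⟨.inr ⟨j, k, hjk, rfl⟩, by simp [dotZ_sub, dotZ_eZ, hj', hk]⟩
      · have h : (1 - ρ k) • eZ n k - (1 : ℤ) • eZ n j = eZ n k - eZ n j := by
          simp [hk]
        rw [h]
        exact ⟨.inr ⟨k, j, hjk.symm, rfl⟩, by simp [dotZ_sub, dotZ_eZ, hj', hk]⟩
    · rcases hε with rfl | rfl
      · have h : (-1 - ρ k) • eZ n k - (-1 : ℤ) • eZ n j = eZ n j := by simp [hk]
        rw [h]
        exact ⟨.inl (.inl ⟨j, rfl⟩), by simp [dotZ_eZ, hj']⟩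
      · have h : (1 - ρ k) • eZ n k - (1 : ℤ) • eZ n j = -eZ n j := by simp [hk]
        rw [h]
        exact ⟨.inl (.inr ⟨j, rfl⟩), by simp [dotZ_neg, dotZ_eZ, hj']⟩

lemma RofRho_eq_union {n : ℕ} {ε : ℤ} (hε : ε = -1 ∨ ε = 1) {ρ : Fin n → ℤ}
    (hρ : ∀ k, ρ k = 0 ∨ ρ k = ε) :
    RofRho n ρ =
      (fun j => -(ε • eZ n j)) '' suppZ n ρ ∪
        (fun p : Fin n × Fin n => ε • eZ n p.2 - ε • eZ n p.1) ''
          (suppZ n ρ ×ˢ (suppZ n ρ)ᶜ) := by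
  rw [RofRho_eq hε hρ]
  ext α
  simp only [suppZ, Set.mem_ofPred_eq, Set.mem_union, Set.mem_image, Set.mem_prod, Prod.exists,
    Set.mem_compl_iff, not_not]
  constructor
  · rintro ⟨j, hj, k, rfl⟩
    rcases hρ k with hk | hk
    · exact .inr ⟨j, k, ⟨hj, hk⟩, by simp [hk]⟩
    · exact .inl ⟨j, hj, by simp [hk]⟩
  · rintro (⟨j, hj, rfl⟩ | ⟨j, k, ⟨hj, hk⟩, rfl⟩)
    · exact ⟨j, hj, j, by simp [(hρ j).resolve_left hj]⟩
    · exact ⟨j, hj, k, by simp [hk]⟩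

lemma ncard_RofRho {n : ℕ} {ε : ℤ} (hε : ε = -1 ∨ ε = 1) {ρ : Fin n → ℤ}
    (hρ : ∀ k, ρ k = 0 ∨ ρ k = ε) :
    (RofRho n ρ).ncard = (suppZ n ρ).ncard * (n + 1 - (suppZ n ρ).ncard) := by
  have hε0 : ε ≠ 0 := by rintro rfl; simp at hε
  have hcompl : (suppZ n ρ).ncard + (suppZ n ρ)ᶜ.ncard = n := by
    simpa using Set.ncard_add_ncard_compl (suppZ n ρ)
  rw [RofRho_eq_union hε hρ, Set.ncard_union_eq, Set.ncard_image_of_injective,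
    Set.InjOn.ncard_image, Set.ncard_prod]
  · rw [show n + 1 - (suppZ n ρ).ncard = (suppZ n ρ)ᶜ.ncard + 1 by lia]
    ring
  · rintro ⟨j, k⟩ ⟨hj, hk⟩ ⟨j', k'⟩ ⟨hj', hk'⟩ h
    have h₁ := congrFun h j
    have h₂ := congrFun h k
    simp only [Pi.sub_apply, Pi.smul_apply, eZ_apply, smul_eq_mul] at h₁ h₂
    simp only [Set.mem_compl_iff] at hj hk hj' hk'
    grind
  · intro j j' h
    have h₁ := congrFun h j
    simp only [Pi.neg_apply, Pi.smul_apply, eZ_apply, smul_eq_mul] at h₁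
    grind
  · rw [Set.disjoint_left]
    rintro _ ⟨i, hi, rfl⟩ ⟨⟨j, k⟩, ⟨hj, hk⟩, h⟩
    have h₁ := congrFun h k
    simp only [Pi.sub_apply, Pi.neg_apply, Pi.smul_apply, eZ_apply, smul_eq_mul] at h₁
    simp only [Set.mem_compl_iff] at hj hk
    grind

/-- Description of `R(ρ)` and its cardinality for `ρ` with coordinates in
`{0, ε}` and nonempty support. -/
theorem RofRho_description (n : ℕ) (hn : 1 ≤ n) (ε : ℤ) (hε : ε = -1 ∨ ε = 1)
    (ρ : Fin n → ℤ) (hρ : ∀ k, ρ k = 0 ∨ ρ k = ε) (hsupp : (suppZ n ρ).Nonempty) :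
    RofRho n ρ =
      {α | ∃ j ∈ suppZ n ρ, ∃ k : Fin n, α = (ε - ρ k) • eZ n k - ε • eZ n j} ∧
    (RofRho n ρ).ncard = (suppZ n ρ).ncard * (n + 1 - (suppZ n ρ).ncard) :=
  ⟨RofRho_eq hε hρ, ncard_RofRho hε hρ⟩
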